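/- arXiv:1510.08749 — 2 statements merged into one kernel-verified Lean document; each statement's English description precedes it below -/
import Mathlib

section
/- If G is a finite connected simple graph of order n(G) at least one, then γ_e(G) ≤ (2/5)(n(G) + 2). -/
open SimpleGraph

/-- The contribution `(1/2)^(d-1)` of a vertex at `S`-restricted distance `d`,
with `(1/2)^∞ = 0`. -/
noncomputable def expStep (d : ℕ∞) : ℝ :=
  if h : d = ⊤ then 0 else (1 / 2 : ℝ) ^ ((d.untop h : ℤ) - 1)

/-- `expDist G S u v` is the minimum number of edges of a walk in `G` from `u` to `v`
such that `v` is the only vertex of the walk belonging to `S` (i.e. the distance from `u`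
to `v ∈ S` in `G - (S \ {v})`), and `⊤` if no such walk exists. -/
noncomputable def expDist {V : Type*} (G : SimpleGraph V) (S : Finset V) (u v : V) : ℕ∞ :=
  sInf {n : ℕ∞ | ∃ p : G.Walk u v, (∀ x ∈ p.support, x ∈ S → x = v) ∧ (p.length : ℕ∞) = n}

/-- The weight `w_{(G,S)}(u) = Σ_{v ∈ S} (1/2)^(dist_{(G,S)}(u,v) - 1)`. -/
noncomputable def expWeight {V : Type*} (G : SimpleGraph V) (S : Finset V) (u : V) : ℝ :=
  ∑ v ∈ S, expStep (expDist G S u v)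

/-- `S` is an exponential dominating set of `G`. -/
def IsExpDomSet {V : Type*} (G : SimpleGraph V) (S : Finset V) : Prop :=
  ∀ u : V, 1 ≤ expWeight G S u

/-- The exponential domination number of `G`. -/
noncomputable def expDomNum {V : Type*} (G : SimpleGraph V) : ℕ :=
  sInf {k : ℕ | ∃ S : Finset V, IsExpDomSet G S ∧ S.card = k}

section ExpDom

variable {V : Type*}

/-- A walk witnessing `expDist`: it meets `S` at most in its final vertex. -/
def AvoidsUntilEnd {G : SimpleGraph V} (S : Finset V) {u v : V} (p : G.Walk u v) : Prop :=
  ∀ x ∈ p.support, x ∈ S → x = v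

theorem expStep_coe (k : ℕ) : expStep (k : ℕ∞) = 2 * (1 / 2 : ℝ) ^ k := by
  have h : (k : ℕ∞) ≠ ⊤ := ENat.natCast_ne_top k
  have h1 : (WithTop.untop (k : ℕ∞) h) = k := rfl
  rw [expStep, dif_neg h, h1, zpow_sub₀ (by norm_num)]
  simp
  ring

theorem expStep_top : expStep ⊤ = 0 := by simp [expStep]

theorem expStep_nonneg (d : ℕ∞) : 0 ≤ expStep d := by
  induction d using ENat.recTopCoe with
  | top => simp [expStep_top]
  | coe k => rw [expStep_coe]; positivity

theorem expStep_antitone : Antitone expStep := by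
  intro a b hab
  induction b using ENat.recTopCoe with
  | top => rw [expStep_top]; exact expStep_nonneg a
  | coe k =>
    lift a to ℕ using ne_top_of_le_ne_top (ENat.natCast_ne_top k) hab
    rw [expStep_coe, expStep_coe]
    have : a ≤ k := by exact_mod_cast hab
    gcongr 2 * ?_
    exact pow_le_pow_of_le_one (by norm_num) (by norm_num) this

theorem le_expStep_expDist {G : SimpleGraph V} {S : Finset V} {u v : V} (p : G.Walk u v)
    (hp : AvoidsUntilEnd S p) : 2 * (1 / 2 : ℝ) ^ p.length ≤ expStep (expDist G S u v) := by
  rw [← expStep_coe]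
  exact expStep_antitone (sInf_le ⟨p, hp, rfl⟩)

/-- Comparison of two contributions by transforming walks. -/
theorem expStep_expDist_le {G G' : SimpleGraph V} {S S' : Finset V} {u v u' v' : V} (a b : ℕ)
    (h : ∀ p : G'.Walk u' v', AvoidsUntilEnd S' p →
      ∃ q : G.Walk u v, AvoidsUntilEnd S q ∧ q.length + a ≤ p.length + b) :
    2 ^ a * expStep (expDist G' S' u' v') ≤ 2 ^ b * expStep (expDist G S u v) := by
  by_cases hne : {n : ℕ∞ | ∃ p : G'.Walk u' v', AvoidsUntilEnd S' p ∧
      (p.length : ℕ∞) = n}.Nonempty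
  · obtain ⟨p, hp, hlen⟩ := csInf_mem hne
    obtain ⟨q, hq, hqp⟩ := h p hp
    have h1 : expDist G' S' u' v' = p.length := hlen.symm
    have h2 := le_expStep_expDist q hq
    rw [h1, expStep_coe]
    calc (2 : ℝ) ^ a * (2 * (1 / 2) ^ p.length)
        = 2 ^ b * (2 * (1 / 2) ^ (p.length + b)) * 2 ^ a := by
          rw [pow_add]; simp only [one_div, inv_pow]; field_simp
      _ ≤ 2 ^ b * (2 * (1 / 2) ^ (q.length + a)) * 2 ^ a := by
          gcongr 2 ^ b * (2 * ?_) * 2 ^ a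
          exact pow_le_pow_of_le_one (by norm_num) (by norm_num) hqp
      _ = 2 ^ b * (2 * (1 / 2) ^ q.length) := by
          rw [pow_add]; simp only [one_div, inv_pow]; field_simp
      _ ≤ _ := by gcongr
  · have h1 : expDist G' S' u' v' = ⊤ := by
      rw [Set.not_nonempty_iff_eq_empty] at hne
      change sInf {n : ℕ∞ | ∃ p : G'.Walk u' v', AvoidsUntilEnd S' p ∧ (p.length : ℕ∞) = n} = ⊤
      rw [hne, sInf_empty]
    rw [h1, expStep_top, mul_zero]
    exact mul_nonneg (by positivity) (expStep_nonneg _)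

theorem two_le_expStep_expDist_self (G : SimpleGraph V) (S : Finset V) (u : V) :
    2 ≤ expStep (expDist G S u u) := by
  simpa using le_expStep_expDist (S := S) (Walk.nil : G.Walk u u) (by simp [AvoidsUntilEnd])

/-- Passing to a neighbour outside `S` at most halves the contribution. -/
theorem expStep_expDist_le_two_mul_of_adj {G : SimpleGraph V} {S : Finset V} {u x v : V}
    (hux : G.Adj u x) (hu : u ∉ S) :
    expStep (expDist G S x v) ≤ 2 * expStep (expDist G S u v) := by
  have := expStep_expDist_le (G := G) (S := S) (u := u) (v := v) (G' := G) (S' := S)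
    (u' := x) (v' := v) 0 1 fun p hp => ⟨Walk.cons hux p, by
      intro y hy hyS
      rcases List.mem_cons.1 (by simpa using hy) with rfl | hy
      · exact absurd hyS hu
      · exact hp y hy hyS, by simp⟩
  simpa using this

/-- A vertex outside `S` all of whose neighbours equal `x` receives at most half of what `x`
receives. -/
theorem two_mul_expStep_expDist_le_of_leaf {G : SimpleGraph V} {S : Finset V} {u x v : V}
    (hux : ∀ y, G.Adj u y → y = x) (huv : u ≠ v) :
    2 * expStep (expDist G S u v) ≤ expStep (expDist G S x v) := by
  have := expStep_expDist_le (G := G) (S := S) (u := x) (v := v) (G' := G) (S' := S)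
    (u' := u) (v' := v) 1 0 fun p hp => by
      cases p with
      | nil => exact absurd rfl huv
      | cons h p =>
        obtain rfl := hux _ h
        exact ⟨p, fun y hy => hp y (by simp [hy]), by simp⟩
  simpa using this

/-- Every edge of `G` has both ends in `U`. -/
def SupportedOn (G : SimpleGraph V) (U : Finset V) : Prop :=
  ∀ u v, G.Adj u v → v ∈ U

theorem SupportedOn.support_subset {G : SimpleGraph V} {U : Finset V} (hG : SupportedOn G U)
    {u v : V} (p : G.Walk u v) (hu : u ∈ U) : ∀ x ∈ p.support, x ∈ U := by
  induction p with
  | nil => simpa using hu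
  | cons h p ih => simpa [hu] using ih (hG _ _ h)

section Compare

variable {G G' : SimpleGraph V} {S S' U : Finset V} {u v : V}

/-- Enlarging the graph does not decrease contributions if no new blocking vertices lie on the
support of the smaller graph. -/
theorem expStep_expDist_mono (hGG : G' ≤ G) (hG' : SupportedOn G' U)
    (hS : ∀ x ∈ S, x ∈ U → x ∈ S') (hu : u ∈ U) :
    expStep (expDist G' S' u v) ≤ expStep (expDist G S u v) := by
  have := expStep_expDist_le (G := G) (S := S) (u := u) (v := v) (G' := G') (S' := S')
    (u' := u) (v' := v) 0 0 fun p hp => ⟨p.mapLe hGG, fun x hx hxS => by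
      rw [Walk.support_mapLe_eq_support] at hx
      exact hp x hx (hS x hxS (hG'.support_subset p hu x hx)), by simp⟩
  simpa using this

/-- Moving a dominating vertex to a neighbour outside the support of the smaller graph at most
halves its contribution. -/
theorem expStep_expDist_le_two_mul_of_adj_right {b : V} (hGG : G' ≤ G) (hG' : SupportedOn G' U)
    (hS : ∀ x ∈ S, x ∈ U → x ∈ S') (hu : u ∈ U) (hvS : v ∉ S) (hvb : G.Adj v b) :
    expStep (expDist G' S' u v) ≤ 2 * expStep (expDist G S u b) := by
  have := expStep_expDist_le (G := G) (S := S) (u := u) (v := b) (G' := G') (S' := S')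
    (u' := u) (v' := v) 0 1 fun p hp => ⟨(p.mapLe hGG).concat hvb, fun x hx hxS => by
      rw [Walk.support_concat, Walk.support_mapLe_eq_support] at hx
      rcases (by simpa using hx) with hx | hx
      · have := hp x hx (hS x hxS (hG'.support_subset p hu x hx))
        exact absurd (this ▸ hxS) hvS
      · exact hx, by simp⟩
  simpa using this

theorem expWeight_le_sum (hGG : G' ≤ G) (hG' : SupportedOn G' U)
    (hS : ∀ x ∈ S, x ∈ U → x ∈ S') (hu : u ∈ U) :
    expWeight G' S' u ≤ ∑ s ∈ S', expStep (expDist G S u s) :=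
  Finset.sum_le_sum fun _ _ => expStep_expDist_mono hGG hG' hS hu

end Compare

theorem sum_le_expWeight (G : SimpleGraph V) {S A : Finset V} (hA : A ⊆ S) (u : V) :
    ∑ s ∈ A, expStep (expDist G S u s) ≤ expWeight G S u :=
  Finset.sum_le_sum_of_subset_of_nonneg hA fun _ _ _ => expStep_nonneg _

theorem one_le_expStep_expDist_of_adj {G : SimpleGraph V} {S : Finset V} {u v : V}
    (h : G.Adj u v) (hu : u ∉ S) : 1 ≤ expStep (expDist G S u v) := by
  have h1 := two_le_expStep_expDist_self G S v
  have h2 := expStep_expDist_le_two_mul_of_adj (v := v) h hu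
  linarith

theorem one_le_expWeight_of_mem {G : SimpleGraph V} {S : Finset V} {u : V} (hu : u ∈ S) :
    1 ≤ expWeight G S u := by
  have h1 := sum_le_expWeight G (Finset.singleton_subset_iff.2 hu) u
  have h2 := two_le_expStep_expDist_self G S u
  rw [Finset.sum_singleton] at h1
  linarith

theorem one_le_expWeight_of_adj {G : SimpleGraph V} {S : Finset V} {u v : V} (h : G.Adj u v)
    (hv : v ∈ S) : 1 ≤ expWeight G S u := by
  by_cases hu : u ∈ S
  · exact one_le_expWeight_of_mem hu
  · have h1 := sum_le_expWeight G (Finset.singleton_subset_iff.2 hv) u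
    rw [Finset.sum_singleton] at h1
    exact (one_le_expStep_expDist_of_adj h hu).trans h1

theorem expWeight_le_two_mul_of_adj {G : SimpleGraph V} {S : Finset V} {u x : V}
    (h : G.Adj u x) (hu : u ∉ S) : expWeight G S x ≤ 2 * expWeight G S u := by
  rw [expWeight, expWeight, Finset.mul_sum]
  exact Finset.sum_le_sum fun _ _ => expStep_expDist_le_two_mul_of_adj h hu

theorem two_mul_expWeight_le_of_leaf {G : SimpleGraph V} {S : Finset V} {u x : V}
    (hux : ∀ y, G.Adj u y → y = x) (hu : u ∉ S) :
    2 * expWeight G S u ≤ expWeight G S x := by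
  rw [expWeight, expWeight, Finset.mul_sum]
  exact Finset.sum_le_sum fun s hs =>
    two_mul_expStep_expDist_le_of_leaf hux fun h => hu (h ▸ hs)

/-- The graph on the vertices in `U` in which `u` and `π u` are joined whenever they differ. -/
def parentGraph (π : V → V) (U : Finset V) : SimpleGraph V where
  Adj u w := u ≠ w ∧ u ∈ U ∧ w ∈ U ∧ (π u = w ∨ π w = u)
  symm := ⟨fun _ _ h => ⟨h.1.symm, h.2.2.1, h.2.1, h.2.2.2.symm⟩⟩
  loopless := ⟨fun _ h => h.1 rfl⟩

/-- The part of the parent graph on `U` has an exponential dominating set of size at most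
`(2 / 5) * (#U + 2)`. -/
def HasSmallExpDomSet (π : V → V) (U : Finset V) : Prop :=
  ∃ S ⊆ U, 5 * S.card ≤ 2 * (U.card + 2) ∧ ∀ u ∈ U, 1 ≤ expWeight (parentGraph π U) S u

section Reductions

variable {π : V → V} {U R N S' : Finset V}

theorem supportedOn_parentGraph : SupportedOn (parentGraph π U) U := fun _ _ h => h.2.2.1

theorem parentGraph_mono {U' : Finset V} (h : U' ⊆ U) : parentGraph π U' ≤ parentGraph π U :=
  fun _ _ hab => ⟨hab.1, h hab.2.1, h hab.2.2.1, hab.2.2.2⟩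

variable [DecidableEq V]

theorem expWeight_sdiff_le_sum (hN : N ⊆ R) {u : V} (hu : u ∈ U \ R) :
    expWeight (parentGraph π (U \ R)) S' u ≤
      ∑ s ∈ S', expStep (expDist (parentGraph π U) (S' ∪ N) u s) := by
  refine expWeight_le_sum (parentGraph_mono Finset.sdiff_subset) supportedOn_parentGraph ?_ hu
  intro x hx hxU
  rcases Finset.mem_union.1 hx with h | h
  · exact h
  · exact absurd (hN h) (Finset.mem_sdiff.1 hxU).2

theorem expWeight_sdiff_le (hN : N ⊆ R) {u : V} (hu : u ∈ U \ R) :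
    expWeight (parentGraph π (U \ R)) S' u ≤ expWeight (parentGraph π U) (S' ∪ N) u :=
  (expWeight_sdiff_le_sum hN hu).trans (sum_le_expWeight _ Finset.subset_union_left u)

/-- Remove a set `R` that is dominated by few of its own vertices. -/
theorem HasSmallExpDomSet.of_dominated (hR : R ⊆ U) (hN : N ⊆ R)
    (hcard : 5 * N.card ≤ 2 * R.card)
    (hdom : ∀ u ∈ R, u ∈ N ∨ ∃ w ∈ N, (parentGraph π U).Adj u w)
    (h : HasSmallExpDomSet π (U \ R)) : HasSmallExpDomSet π U := by
  obtain ⟨S', hS', hc, hw⟩ := h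
  refine ⟨S' ∪ N, Finset.union_subset (hS'.trans Finset.sdiff_subset) (hN.trans hR), ?_, ?_⟩
  · have h1 := Finset.card_union_le S' N
    have h2 := Finset.card_sdiff_add_card_eq_card hR
    omega
  · intro u hu
    by_cases huR : u ∈ R
    · rcases hdom u huR with h | ⟨w, hwN, hadj⟩
      · exact one_le_expWeight_of_mem (Finset.mem_union_right _ h)
      · exact one_le_expWeight_of_adj hadj (Finset.mem_union_right _ hwN)
    · have huR' := Finset.mem_sdiff.2 ⟨hu, huR⟩
      exact (hw u huR').trans (expWeight_sdiff_le hN huR')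

/-- Remove a leaf `x` and a pendant path `b c` attached to the same vertex `v`. -/
theorem HasSmallExpDomSet.of_leaf_of_path {v x b c : V} (hvR : v ∈ U \ {x, b, c})
    (hcard : ({x, b, c} : Finset V).card = 3) (hxv : (parentGraph π U).Adj x v)
    (hbv : (parentGraph π U).Adj b v) (hcb : (parentGraph π U).Adj c b)
    (h : HasSmallExpDomSet π (U \ {x, b, c})) : HasSmallExpDomSet π U := by
  obtain ⟨S', hS', hc, hw⟩ := h
  have hR : {x, b, c} ⊆ U := by
    intro y hy
    simp only [Finset.mem_insert, Finset.mem_singleton] at hy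
    rcases hy with rfl | rfl | rfl
    exacts [hxv.2.1, hbv.2.1, hcb.2.1]
  have hN : {b} ⊆ ({x, b, c} : Finset V) := by simp
  have hbS : b ∈ S' ∪ {b} := by simp
  have hbS' : b ∉ S' := fun h => by simpa using hS' h
  refine ⟨S' ∪ {b}, Finset.union_subset (hS'.trans Finset.sdiff_subset) (hN.trans hR), ?_, ?_⟩
  · have h1 := Finset.card_union_le S' {b}
    have h2 := Finset.card_sdiff_add_card_eq_card hR
    simp only [Finset.card_singleton] at h1
    omega
  · intro u hu
    by_cases huR : u ∈ ({x, b, c} : Finset V)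
    · simp only [Finset.mem_insert, Finset.mem_singleton] at huR
      rcases huR with rfl | rfl | rfl
      · by_cases hv : v ∈ S'
        · exact one_le_expWeight_of_adj hxv (Finset.mem_union_left _ hv)
        · have hvS : v ∉ S' ∪ {b} := by
            rw [Finset.mem_union, Finset.mem_singleton]
            rintro (h | h)
            · exact hv h
            · exact hbv.1 h.symm
          by_cases huS : u ∈ S' ∪ {b}
          · exact one_le_expWeight_of_mem huS
          · have h1 := expWeight_le_two_mul_of_adj hxv huS
            have h2 := (hw v hvR).trans (expWeight_sdiff_le_sum hN hvR)
            have h3 := one_le_expStep_expDist_of_adj hbv.symm hvS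
            have h4 : expWeight (parentGraph π U) (S' ∪ {b}) v = _ :=
              Finset.sum_union (Finset.disjoint_singleton_right.2 hbS')
            rw [Finset.sum_singleton] at h4
            linarith
      · exact one_le_expWeight_of_mem hbS
      · exact one_le_expWeight_of_adj hcb hbS
    · have huR' := Finset.mem_sdiff.2 ⟨hu, huR⟩
      exact (hw u huR').trans (expWeight_sdiff_le hN huR')

/-- Of three pendant paths `b₁ c₁`, `b₂ c₂`, `b₃ c₃` attached to the same vertex `v`,
remove all vertices except `b₃`. -/
theorem HasSmallExpDomSet.of_three_paths {v b₁ b₂ b₃ c₁ c₂ c₃ : V}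
    (hvR : v ∈ U \ {b₁, b₂, c₁, c₂, c₃}) (hbR : b₃ ∈ U \ {b₁, b₂, c₁, c₂, c₃})
    (hcard : ({b₁, b₂, c₁, c₂, c₃} : Finset V).card = 5) (hb : b₁ ≠ b₂)
    (h₁ : (parentGraph π U).Adj b₁ v) (h₂ : (parentGraph π U).Adj b₂ v)
    (h₃ : (parentGraph π U).Adj b₃ v) (hc₁ : (parentGraph π U).Adj c₁ b₁)
    (hc₂ : (parentGraph π U).Adj c₂ b₂) (hc₃ : (parentGraph π U).Adj c₃ b₃)
    (hleaf : ∀ y, (parentGraph π (U \ {b₁, b₂, c₁, c₂, c₃})).Adj b₃ y → y = v)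
    (h : HasSmallExpDomSet π (U \ {b₁, b₂, c₁, c₂, c₃})) : HasSmallExpDomSet π U := by
  have hR : {b₁, b₂, c₁, c₂, c₃} ⊆ U := by
    intro y hy
    simp only [Finset.mem_insert, Finset.mem_singleton] at hy
    rcases hy with rfl | rfl | rfl | rfl | rfl
    exacts [h₁.2.1, h₂.2.1, hc₁.2.1, hc₂.2.1, hc₃.2.1]
  have hb₁R : b₁ ∈ ({b₁, b₂, c₁, c₂, c₃} : Finset V) := by simp
  have hb₂R : b₂ ∈ ({b₁, b₂, c₁, c₂, c₃} : Finset V) := by simp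
  have hc₃R : c₃ ∈ ({b₁, b₂, c₁, c₂, c₃} : Finset V) := by simp
  have hmem : ∀ u ∈ ({b₁, b₂, c₁, c₂, c₃} : Finset V),
      u = b₁ ∨ u = b₂ ∨ u = c₁ ∨ u = c₂ ∨ u = c₃ := by simp
  generalize hRdef : ({b₁, b₂, c₁, c₂, c₃} : Finset V) = R at *
  clear hRdef
  obtain ⟨S', hS', hc, hw⟩ := h
  have hdisj : ∀ x ∈ S', x ∉ R := fun x hx => (Finset.mem_sdiff.1 (hS' hx)).2
  have h2 := Finset.card_sdiff_add_card_eq_card hR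
  have hS'U : S' ⊆ U := hS'.trans Finset.sdiff_subset
  by_cases hv : v ∈ S'
  · have hN : {b₁, b₂, c₃} ⊆ R := by
      simp [Finset.insert_subset_iff, hb₁R, hb₂R, hc₃R]
    have hb₁S : b₁ ∈ S'.erase v ∪ {b₁, b₂, c₃} := by simp
    have hb₂S : b₂ ∈ S'.erase v ∪ {b₁, b₂, c₃} := by simp
    have hc₃S : c₃ ∈ S'.erase v ∪ {b₁, b₂, c₃} := by simp
    have hSS' : ∀ x ∈ S'.erase v ∪ {b₁, b₂, c₃}, x ∈ U \ R → x ∈ S' := by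
      intro x hx hxU
      rcases Finset.mem_union.1 hx with h | h
      · exact Finset.mem_of_mem_erase h
      · exact absurd (hN h) (Finset.mem_sdiff.1 hxU).2
    have hvS : v ∉ S'.erase v ∪ {b₁, b₂, c₃} := by
      rw [Finset.mem_union]
      rintro (h | h)
      · exact Finset.notMem_erase v S' h
      · exact (Finset.mem_sdiff.1 hvR).2 (hN h)
    refine ⟨S'.erase v ∪ {b₁, b₂, c₃},
      Finset.union_subset ((Finset.erase_subset _ _).trans hS'U) (hN.trans hR), ?_, ?_⟩
    · have h1 := Finset.card_union_le (S'.erase v) {b₁, b₂, c₃}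
      have h3 := Finset.card_erase_add_one hv
      have h4 := Finset.card_le_three (a := b₁) (b := b₂) (c := c₃)
      omega
    · intro u hu
      by_cases huR : u ∈ R
      · rcases hmem u huR with rfl | rfl | rfl | rfl | rfl
        · exact one_le_expWeight_of_mem hb₁S
        · exact one_le_expWeight_of_mem hb₂S
        · exact one_le_expWeight_of_adj hc₁ hb₁S
        · exact one_le_expWeight_of_adj hc₂ hb₂S
        · exact one_le_expWeight_of_mem hc₃S
      · have huR' := Finset.mem_sdiff.2 ⟨hu, huR⟩
        generalize hS : S'.erase v ∪ {b₁, b₂, c₃} = S at *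
        have hGG : parentGraph π (U \ R) ≤ parentGraph π U := parentGraph_mono Finset.sdiff_subset
        have e1 := expStep_expDist_le_two_mul_of_adj_right hGG supportedOn_parentGraph hSS' huR'
          hvS h₁.symm
        have e2 := expStep_expDist_le_two_mul_of_adj_right hGG supportedOn_parentGraph hSS' huR'
          hvS h₂.symm
        have e3 : ∑ s ∈ S'.erase v, expStep (expDist (parentGraph π (U \ R)) S' u s) ≤
            ∑ s ∈ S'.erase v, expStep (expDist (parentGraph π U) S u s) :=
          Finset.sum_le_sum fun _ _ => expStep_expDist_mono hGG supportedOn_parentGraph hSS' huR'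
        have e4 : expWeight (parentGraph π (U \ R)) S' u = _ :=
          (Finset.sum_erase_add S' _ hv).symm
        have hd : Disjoint (S'.erase v) {b₁, b₂} := by
          rw [Finset.disjoint_left]
          intro x hx hx'
          refine hdisj x (Finset.mem_of_mem_erase hx) ?_
          simp only [Finset.mem_insert, Finset.mem_singleton] at hx'
          rcases hx' with rfl | rfl <;> assumption
        have e5 := sum_le_expWeight (parentGraph π U) (S := S)
          (A := S'.erase v ∪ {b₁, b₂}) (by
            rw [← hS]
            refine Finset.union_subset_union_right ?_
            intro x
            simp only [Finset.mem_insert, Finset.mem_singleton]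
            tauto) u
        rw [Finset.sum_union hd, Finset.sum_pair hb] at e5
        have := hw u huR'
        linarith
  · have hN : {b₁, b₂} ⊆ R := by
      simp [Finset.insert_subset_iff, hb₁R, hb₂R]
    have hb₁S : b₁ ∈ S' ∪ {b₁, b₂} := by simp
    have hb₂S : b₂ ∈ S' ∪ {b₁, b₂} := by simp
    refine ⟨S' ∪ {b₁, b₂}, Finset.union_subset hS'U (hN.trans hR), ?_, ?_⟩
    · have h1 := Finset.card_union_le S' {b₁, b₂}
      have h4 := Finset.card_le_two (a := b₁) (b := b₂)
      omega
    · intro u hu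
      by_cases huR : u ∈ R
      · rcases hmem u huR with rfl | rfl | rfl | rfl | rfl
        · exact one_le_expWeight_of_mem hb₁S
        · exact one_le_expWeight_of_mem hb₂S
        · exact one_le_expWeight_of_adj hc₁ hb₁S
        · exact one_le_expWeight_of_adj hc₂ hb₂S
        · by_cases hyS' : b₃ ∈ S'
          · exact one_le_expWeight_of_adj hc₃ (Finset.mem_union_left _ hyS')
          have hmemS : ∀ x ∈ U \ R, x ∉ S' → x ∉ S' ∪ {b₁, b₂} := by
            intro x hx hxS' h
            rcases Finset.mem_union.1 h with h | h
            · exact hxS' h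
            · exact (Finset.mem_sdiff.1 hx).2 (hN h)
          by_cases huS : u ∈ S' ∪ {b₁, b₂}
          · exact one_le_expWeight_of_mem huS
          have hvS := hmemS v hvR hv
          have e1 := expWeight_le_two_mul_of_adj hc₃ huS
          have e2 := expWeight_le_two_mul_of_adj h₃ (hmemS b₃ hbR hyS')
          have e3 := two_mul_expWeight_le_of_leaf hleaf hyS'
          have e4 := hw b₃ hbR
          have e5 := expWeight_sdiff_le_sum (π := π) (S' := S') hN hvR
          have e6 := one_le_expStep_expDist_of_adj h₁.symm hvS
          have e7 := one_le_expStep_expDist_of_adj h₂.symm hvS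
          have hd : Disjoint S' {b₁, b₂} :=
            Finset.disjoint_left.2 fun x hx hx' => hdisj x hx (hN hx')
          have e8 : expWeight (parentGraph π U) (S' ∪ {b₁, b₂}) v = _ := Finset.sum_union hd
          rw [Finset.sum_pair hb] at e8
          linarith
      · have huR' := Finset.mem_sdiff.2 ⟨hu, huR⟩
        exact (hw u huR').trans (expWeight_sdiff_le hN huR')

end Reductions

/-- `π` is the parent function of a tree with root `r` and depth function `d`. -/
structure IsParentFun (π : V → V) (r : V) (d : V → ℕ) : Prop where
  depth_eq_zero_iff : ∀ u, d u = 0 ↔ u = r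
  parent_root : π r = r
  depth_parent : ∀ u, u ≠ r → d (π u) + 1 = d u

section Induction

variable {π : V → V} {r : V} {d : V → ℕ}

theorem IsParentFun.adj (h : IsParentFun π r d) {U : Finset V} {u w : V} (hu : u ∈ U) (hw : w ∈ U)
    (hur : u ≠ r) (huw : π u = w) : (parentGraph π U).Adj u w := by
  refine ⟨?_, hu, hw, Or.inl huw⟩
  rintro rfl
  have := h.depth_parent u hur
  rw [huw] at this
  omega

theorem IsParentFun.hasSmallExpDomSet (h : IsParentFun π r d) (U : Finset V)
    (hU : ∀ u ∈ U, π u ∈ U) : HasSmallExpDomSet π U := by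
  classical
  induction U using Finset.strongInduction with
  | H U ih =>
  have hrec : ∀ R ⊆ U, R.Nonempty → (∀ u ∈ U, u ≠ r → π u ∈ R → u ∈ R) →
      HasSmallExpDomSet π (U \ R) := by
    intro R hR hne hdesc
    refine ih _ (Finset.sdiff_ssubset hR hne) fun u hu => ?_
    rw [Finset.mem_sdiff] at hu ⊢
    refine ⟨hU u hu.1, fun hπR => hu.2 ?_⟩
    by_cases hur : u = r
    · rwa [hur, h.parent_root, ← hur] at hπR
    · exact hdesc u hu.1 hur hπR
  by_cases hflat : ∀ u ∈ U, π u = r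
  · rcases U.eq_empty_or_nonempty with rfl | ⟨x, hx⟩
    · exact ⟨∅, by simp, by simp, by simp⟩
    · have hrU : r ∈ U := hflat x hx ▸ hU x hx
      refine ⟨{r}, by simpa using hrU, ?_, fun u hu => ?_⟩
      · have := Finset.card_pos.2 ⟨x, hx⟩
        simp only [Finset.card_singleton]
        omega
      · by_cases hur : u = r
        · exact one_le_expWeight_of_mem (by simpa using hur)
        · exact one_le_expWeight_of_adj (h.adj hu hrU hur (hflat u hu)) (by simp)
  push Not at hflat
  obtain ⟨u₀, hu₀, hu₀r⟩ := hflat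
  obtain ⟨c, hc, hmax⟩ := U.exists_max_image d ⟨u₀, hu₀⟩
  have hd0 := h.depth_eq_zero_iff
  have hdπ := h.depth_parent
  have hπr := h.parent_root
  have hd2 : 2 ≤ d c := by
    have h1 := hdπ u₀ (fun e => hu₀r (by rw [e, hπr]))
    have h2 := hdπ _ hu₀r
    have h3 := hmax u₀ hu₀
    omega
  have hcr : c ≠ r := by
    intro e
    have := (hd0 c).2 e
    omega
  obtain ⟨b, hb⟩ : ∃ b, π c = b := ⟨_, rfl⟩
  have hbU : b ∈ U := hb ▸ hU c hc
  have hdb : d b + 1 = d c := hb ▸ hdπ c hcr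
  have hbr : b ≠ r := by
    intro e
    have := (hd0 b).2 e
    omega
  obtain ⟨v, hv⟩ : ∃ v, π b = v := ⟨_, rfl⟩
  have hvU : v ∈ U := hv ▸ hU b hbU
  have hdv : d v + 1 = d b := hv ▸ hdπ b hbr
  obtain ⟨K, hK⟩ : ∃ K : V → Finset V, ∀ w z, z ∈ K w ↔ z ∈ U ∧ z ≠ r ∧ π z = w :=
    ⟨fun w => U.filter fun z => z ≠ r ∧ π z = w, fun w z => by simp⟩
  have hKd : ∀ w z, z ∈ K w → d w + 1 = d z := by
    intro w z hz
    obtain ⟨-, h1, rfl⟩ := (hK w z).1 hz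
    exact hdπ z h1
  have hKadj : ∀ w ∈ U, ∀ z ∈ K w, (parentGraph π U).Adj z w := by
    intro w hw z hz
    obtain ⟨h0, h1, h2⟩ := (hK w z).1 hz
    exact h.adj h0 hw h1 h2
  have hKU : ∀ w z, z ∈ K w → z ∈ U := fun w z hz => ((hK w z).1 hz).1
  have hKπ : ∀ w z, z ∈ K w → π z = w := fun w z hz => ((hK w z).1 hz).2.2
  have hKc : ∀ w, d w = d c → ∀ z, z ∉ K w := by
    intro w hw z hz
    have := hKd w z hz
    have := hmax z (hKU w z hz)
    omega
  have hcK : c ∈ K b := (hK b c).2 ⟨hc, hcr, hb⟩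
  have hbK : b ∈ K v := (hK v b).2 ⟨hbU, hbr, hv⟩
  have hdesc_iff : ∀ R, (∀ w ∈ R, K w ⊆ R) → ∀ u ∈ U, u ≠ r → π u ∈ R → u ∈ R :=
    fun R hR u hu hur hπ => hR _ hπ ((hK _ _).2 ⟨hu, hur, rfl⟩)
  by_cases hstar : ∃ w ∈ U, d w + 1 = d c ∧ 2 ≤ (K w).card
  · obtain ⟨w, hw, hdw, hcard⟩ := hstar
    have hwK : w ∉ K w := fun hh => by
      have := hKd w w hh
      omega
    have hsub : insert w (K w) ⊆ U :=
      Finset.insert_subset hw fun z hz => hKU w z hz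
    refine HasSmallExpDomSet.of_dominated (R := insert w (K w)) (N := {w}) hsub (by simp) ?_ ?_
      (hrec _ hsub (Finset.insert_nonempty _ _) (hdesc_iff _ ?_))
    · rw [Finset.card_insert_of_notMem hwK, Finset.card_singleton]
      omega
    · intro u hu
      rcases Finset.mem_insert.1 hu with rfl | hu
      · simp
      · exact Or.inr ⟨w, by simp, hKadj w hw u hu⟩
    · intro z hz
      rcases Finset.mem_insert.1 hz with rfl | hz
      · exact Finset.subset_insert _ _
      · intro y hy
        exact absurd hy (hKc z (by rw [← hKd w z hz, hdw]) y)
  push Not at hstar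
  have hKone : ∀ z ∈ K v, ∀ y, y ∈ K z → K z = {y} := by
    intro z hz y hy
    have h1 := hstar z (hKU v z hz) (by rw [← hKd v z hz, hdv, hdb])
    exact Finset.eq_singleton_iff_unique_mem.2 ⟨hy, fun x hx =>
      Finset.card_le_one.1 (by omega) x hx y hy⟩
  have hKempty : ∀ z ∈ K v, ∀ y ∈ K z, K y = ∅ := by
    intro z hz y hy
    refine Finset.eq_empty_of_forall_notMem (hKc y ?_)
    rw [← hKd z y hy, ← hKd v z hz, hdv, hdb]
  by_cases hleaf : ∃ x ∈ K v, K x = ∅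
  · obtain ⟨x, hx, hxe⟩ := hleaf
    have hdx := hKd v x hx
    have hxb : x ≠ b := by
      rintro rfl
      simp [hxe] at hcK
    have hxc : x ≠ c := by
      rintro rfl
      omega
    have hbc : b ≠ c := by
      rintro rfl
      omega
    have hvx : v ≠ x := by
      rintro rfl
      omega
    have hvb : v ≠ b := by
      rintro rfl
      omega
    have hvc : v ≠ c := by
      rintro rfl
      omega
    refine HasSmallExpDomSet.of_leaf_of_path (v := v) (x := x) (b := b) (c := c)
      (by simp [hvU, hvx, hvb, hvc]) (Finset.card_eq_three.2 ⟨x, b, c, hxb, hxc, hbc, rfl⟩)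
      (hKadj v hvU x hx) (hKadj v hvU b hbK) (hKadj b hbU c hcK)
      (hrec _ ?_ (Finset.insert_nonempty _ _) (hdesc_iff _ ?_))
    · simp [Finset.insert_subset_iff, hKU v x hx, hbU, hc]
    · simp [hxe, hKone b hbK c hcK, hKempty b hbK c hcK]
  push Not at hleaf
  have hpath : ∀ x ∈ K v, ∃ y ∈ K x, K x = {y} ∧ K y = ∅ := by
    intro x hx
    obtain ⟨y, hy⟩ := hleaf x hx
    exact ⟨y, hy, hKone x hx y hy, hKempty x hx y hy⟩
  by_cases hthree : 2 < (K v).card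
  · obtain ⟨b₁, hb₁, b₂, hb₂, b₃, hb₃, h12, h13, h23⟩ := Finset.two_lt_card.1 hthree
    obtain ⟨c₁, hc₁, hc₁K, hc₁e⟩ := hpath b₁ hb₁
    obtain ⟨c₂, hc₂, hc₂K, hc₂e⟩ := hpath b₂ hb₂
    obtain ⟨c₃, hc₃, hc₃K, hc₃e⟩ := hpath b₃ hb₃
    have hb₁U := hKU _ _ hb₁
    have hb₂U := hKU _ _ hb₂
    have hb₃U := hKU _ _ hb₃
    have hdb₁ := hKd _ _ hb₁
    have hdc₁ := hKd _ _ hc₁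
    have hπc₁ := hKπ _ _ hc₁
    have hdb₂ := hKd _ _ hb₂
    have hdc₂ := hKd _ _ hc₂
    have hπc₂ := hKπ _ _ hc₂
    have hdb₃ := hKd _ _ hb₃
    have hdc₃ := hKd _ _ hc₃
    have hπc₃ := hKπ _ _ hc₃
    have hvR : v ∈ U \ {b₁, b₂, c₁, c₂, c₃} := by
      clear ih hrec hdesc_iff hpath hKone hKempty hK hKd hKadj hKU hKπ
        hKc hstar hleaf hU hmax hd0 hdπ
      grind
    have hbR : b₃ ∈ U \ {b₁, b₂, c₁, c₂, c₃} := by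
      clear ih hrec hdesc_iff hpath hKone hKempty hK hKd hKadj hKU hKπ
        hKc hstar hleaf hU hmax hd0 hdπ
      grind
    refine HasSmallExpDomSet.of_three_paths (v := v) (b₁ := b₁) (b₂ := b₂) (b₃ := b₃) (c₁ := c₁)
      (c₂ := c₂) (c₃ := c₃) hvR hbR ?_ h12
      (hKadj v hvU _ hb₁) (hKadj v hvU _ hb₂) (hKadj v hvU _ hb₃) (hKadj _ hb₁U _ hc₁)
      (hKadj _ hb₂U _ hc₂) (hKadj _ hb₃U _ hc₃) ?_
      (hrec _ ?_ (Finset.insert_nonempty _ _) (hdesc_iff _ ?_))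
    · clear ih hrec hdesc_iff hpath hKone hKempty hK hKd hKadj hKU hKπ
        hKc hstar hleaf hU hmax hd0 hdπ
      rw [Finset.card_insert_of_notMem, Finset.card_insert_of_notMem, Finset.card_insert_of_notMem,
        Finset.card_insert_of_notMem, Finset.card_singleton] <;> grind
    · rintro y ⟨hne, -, hy, h' | h'⟩
      · rw [← h', hKπ v b₃ hb₃]
      · rw [Finset.mem_sdiff] at hy
        have hyr : y ≠ r := by
          rintro rfl
          exact hne (h' ▸ hπr)
        have : y ∈ K b₃ := (hK _ _).2 ⟨hy.1, hyr, h'⟩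
        rw [hc₃K, Finset.mem_singleton] at this
        exact absurd (by simp [this]) hy.2
    · simp [Finset.insert_subset_iff, hb₁U, hb₂U, hKU _ _ hc₁, hKU _ _ hc₂, hKU _ _ hc₃]
    · simp [hc₁K, hc₂K, hc₁e, hc₂e, hc₃e]
  by_cases htwo : (K v).card = 2
  · obtain ⟨b₁, b₂, h12, hKv⟩ := Finset.card_eq_two.1 htwo
    have hb₁ : b₁ ∈ K v := by simp [hKv]
    have hb₂ : b₂ ∈ K v := by simp [hKv]
    obtain ⟨c₁, hc₁, hc₁K, hc₁e⟩ := hpath b₁ hb₁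
    obtain ⟨c₂, hc₂, hc₂K, hc₂e⟩ := hpath b₂ hb₂
    have hb₁U := hKU _ _ hb₁
    have hb₂U := hKU _ _ hb₂
    have hdb₁ := hKd _ _ hb₁
    have hdc₁ := hKd _ _ hc₁
    have hπc₁ := hKπ _ _ hc₁
    have hdb₂ := hKd _ _ hb₂
    have hdc₂ := hKd _ _ hc₂
    have hπc₂ := hKπ _ _ hc₂
    have hsub : {v, b₁, b₂, c₁, c₂} ⊆ U := by
      simp [Finset.insert_subset_iff, hvU, hb₁U, hb₂U, hKU _ _ hc₁, hKU _ _ hc₂]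
    refine HasSmallExpDomSet.of_dominated (R := {v, b₁, b₂, c₁, c₂}) (N := {b₁, b₂}) hsub ?_ ?_ ?_
      (hrec _ hsub (Finset.insert_nonempty _ _) (hdesc_iff _ ?_))
    · simp [Finset.insert_subset_iff]
    · clear ih hrec hdesc_iff hpath hKone hKempty hK hKd hKadj hKU hKπ
        hKc hstar hleaf hU hmax hd0 hdπ
      rw [Finset.card_pair h12, Finset.card_insert_of_notMem, Finset.card_insert_of_notMem,
        Finset.card_insert_of_notMem, Finset.card_insert_of_notMem, Finset.card_singleton] <;> grind
    · have hadj := (hKadj v hvU _ hb₁).symm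
      have hadj₁ := hKadj _ hb₁U _ hc₁
      have hadj₂ := hKadj _ hb₂U _ hc₂
      clear ih hrec hdesc_iff hpath hKone hKempty hK hKd hKadj hKU hKπ
        hKc hstar hleaf hU hmax hd0 hdπ
      grind
    · simp [hKv, hc₁K, hc₂K, hc₁e, hc₂e, Finset.insert_subset_iff]
  · have hKv : K v = {b} :=
      Finset.eq_singleton_iff_unique_mem.2 ⟨hbK, fun x hx =>
        Finset.card_le_one.1 (by omega) x hx b hbK⟩
    have hsub : {v, b, c} ⊆ U := by simp [Finset.insert_subset_iff, hvU, hbU, hc]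
    refine HasSmallExpDomSet.of_dominated (R := {v, b, c}) (N := {b}) hsub (by simp) ?_ ?_
      (hrec _ hsub (Finset.insert_nonempty _ _) (hdesc_iff _ ?_))
    · clear ih hrec hdesc_iff hpath hKone hKempty hK hKd hKadj hKU hKπ
        hKc hstar hleaf hU hmax hd0 hdπ
      rw [Finset.card_singleton, Finset.card_insert_of_notMem, Finset.card_insert_of_notMem,
        Finset.card_singleton] <;> grind
    · have hadj := (hKadj v hvU _ hbK).symm
      have hadj' := hKadj _ hbU _ hcK
      clear ih hrec hdesc_iff hpath hKone hKempty hK hKd hKadj hKU hKπ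
        hKc hstar hleaf hU hmax hd0 hdπ
      grind
    · simp [hKv, hKone b hbK c hcK, hKempty b hbK c hcK]

end Induction

/-- A connected graph has a breadth-first search tree. -/
theorem SimpleGraph.Connected.exists_isParentFun {G : SimpleGraph V} (hG : G.Connected) (r : V) :
    ∃ π : V → V, IsParentFun π r (G.dist r) ∧ ∀ u, u ≠ r → G.Adj u (π u) := by
  classical
  have key : ∀ u, u ≠ r → ∃ w, G.Adj u w ∧ G.dist r w + 1 = G.dist r u := by
    intro u hu
    obtain ⟨p, hp⟩ := hG.exists_walk_length_eq_dist u r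
    cases p with
    | nil => exact absurd rfl hu
    | @cons _ w _ hadj q =>
      refine ⟨w, hadj, ?_⟩
      have h1 := dist_le q
      have h2 := hG.dist_triangle (u := u) (v := w) (w := r)
      rw [dist_eq_one_iff_adj.2 hadj] at h2
      rw [Walk.length_cons] at hp
      rw [dist_comm, dist_comm (u := r)]
      omega
  choose! f hf using key
  refine ⟨fun u => if u = r then r else f u, ⟨fun u => ?_, by simp, fun u hu => ?_⟩, fun u hu => ?_⟩
  · rw [hG.dist_eq_zero_iff, eq_comm]
  · simpa [hu] using (hf u hu).2
  · simpa [hu] using (hf u hu).1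

theorem IsParentFun.parentGraph_le {π : V → V} {r : V} {d : V → ℕ} (h : IsParentFun π r d)
    {G : SimpleGraph V} (hG : ∀ u, u ≠ r → G.Adj u (π u)) (U : Finset V) :
    parentGraph π U ≤ G := by
  rintro u w ⟨hne, -, -, rfl | rfl⟩
  · exact hG u fun e => hne (by rw [e, h.parent_root])
  · exact (hG w fun e => hne (by rw [e, h.parent_root])).symm

end ExpDom

/-- Dankelmann et al.: for a connected graph `G` of order `n(G) ≥ 1`,
`γ_e(G) ≤ (2/5)(n(G) + 2)`. -/
theorem expDomNum_upper_bound_two_fifths {V : Type*} [Fintype V] [Nonempty V]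
    (G : SimpleGraph V) (hG : G.Connected) :
    (expDomNum G : ℝ) ≤ (2 / 5) * ((Fintype.card V : ℝ) + 2) := by
  obtain ⟨r⟩ := ‹Nonempty V›
  obtain ⟨π, hπ, hadj⟩ := hG.exists_isParentFun r
  obtain ⟨S, -, hcard, hS⟩ := hπ.hasSmallExpDomSet Finset.univ (by simp)
  have hdom : IsExpDomSet G S := fun u =>
    (hS u (Finset.mem_univ u)).trans (expWeight_le_sum (hπ.parentGraph_le hadj _)
      supportedOn_parentGraph (fun _ hx _ => hx) (Finset.mem_univ u))
  have h1 : expDomNum G ≤ S.card := Nat.sInf_le ⟨S, hdom, rfl⟩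
  have h2 : (5 * S.card : ℝ) ≤ 2 * (Fintype.card V + 2) := by
    rw [Finset.card_univ] at hcard
    exact_mod_cast hcard
  have h3 : (expDomNum G : ℝ) ≤ S.card := by exact_mod_cast h1
  linarith
end

section
/- If T is a binary rooted tree with root r (a finite rooted tree in which every vertex has at most two children) and S is any set of vertices of T, then w_{(T,S)}(r) ≤ 2. -/
open SimpleGraph

/-- `v` can be reached from `u` along a walk that meets `S` at most in `v`. -/
def ReachableAvoiding {V : Type*} (G : SimpleGraph V) (S : Finset V) (u v : V) : Prop :=
  ∃ p : G.Walk u v, ∀ x ∈ p.support, x ∈ S → x = v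

theorem ReachableAvoiding.exists_parent {V : Type*} {T : SimpleGraph V} (hT : T.IsTree)
    {S : Finset V} {r v : V} {n : ℕ} (h : ReachableAvoiding T S r v)
    (hn : T.dist r v = n + 1) :
    ∃ u, T.Adj u v ∧ T.dist r u = n ∧ ReachableAvoiding T S r u ∧ u ∉ S := by
  classical
  obtain ⟨p, hp⟩ := h
  obtain ⟨q, hq⟩ := hT.connected.exists_walk_length_eq_dist r v
  have hqp : q = p.bypass := (hT.existsUnique_path r v).unique
    (q.isPath_of_length_eq_dist hq) p.bypass_isPath
  have hsub : q.support ⊆ p.support := hqp ▸ p.support_bypass_subset_support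
  have hnil : ¬ q.Nil := by
    rw [← Walk.length_eq_zero_iff]
    omega
  have hadj : T.Adj q.penultimate v := q.adj_penultimate hnil
  have hlen : q.dropLast.length = n := by
    rw [Walk.length_dropLast]; omega
  have hmem : ∀ x ∈ q.dropLast.support, x ∉ S := by
    intro x hx hxS
    have hxq : x ∈ q.support := by
      rw [Walk.support_dropLast hnil] at hx
      exact List.mem_of_mem_dropLast hx
    obtain rfl := hp x (hsub hxq) hxS
    have h₁ := T.dist_le (q.dropLast.takeUntil x hx)
    have h₂ := q.dropLast.length_takeUntil_le_length hx
    omega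
  refine ⟨q.penultimate, hadj, ?_, ⟨q.dropLast, fun x hx hxS => absurd hxS (hmem x hx)⟩,
    hmem _ q.dropLast.end_mem_support⟩
  have h₁ := T.dist_le q.dropLast
  have h₂ := hT.connected.dist_triangle (u := r) (v := q.penultimate) (w := v)
  have h₃ := dist_eq_one_iff_adj.2 hadj
  omega

theorem expStep_le_of_le {n : ℕ} {d : ℕ∞} (h : (n : ℕ∞) ≤ d) :
    expStep d ≤ 2 * (1 / 2 : ℝ) ^ n := by
  unfold expStep
  split_ifs with hd
  · positivity
  · lift d to ℕ using hd
    have hnd : n ≤ d := by exact_mod_cast h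
    have h₁ : (1 / 2 : ℝ) ^ d ≤ (1 / 2) ^ n :=
      pow_le_pow_of_le_one (by norm_num) (by norm_num) hnd
    have h₂ : (1 / 2 : ℝ) ^ ((d : ℤ) - 1) = 2 * (1 / 2) ^ d := by
      rw [zpow_sub₀ (by norm_num), zpow_natCast, zpow_one]
      ring
    change (1 / 2 : ℝ) ^ ((d : ℤ) - 1) ≤ _
    linarith

theorem dist_le_expDist {V : Type*} (G : SimpleGraph V) (S : Finset V) (u v : V) :
    (G.dist u v : ℕ∞) ≤ expDist G S u v := by
  refine le_sInf ?_
  rintro _ ⟨p, -, rfl⟩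
  exact_mod_cast G.dist_le p

theorem expDist_eq_top {V : Type*} {G : SimpleGraph V} {S : Finset V} {u v : V}
    (h : ¬ ReachableAvoiding G S u v) : expDist G S u v = ⊤ := by
  refine sInf_eq_top.2 ?_
  rintro _ ⟨p, hp, -⟩
  exact absurd ⟨p, hp⟩ h

open Classical in
/-- A Kraft inequality for the first vertices of `S` met below the root, up to depth `n`,
together with the vertices of depth `n` that are reached without meeting `S`. -/
theorem sum_half_pow_dist_add_card_le_one {V : Type*} [Fintype V]
    (T : SimpleGraph V) [DecidableRel T.Adj] (hT : T.IsTree) (r : V)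
    (hbin : ∀ v : V,
      ((T.neighborFinset v).filter fun w => T.dist r w = T.dist r v + 1).card ≤ 2)
    (S : Finset V) (n : ℕ) :
    ∑ v ∈ S with ReachableAvoiding T S r v ∧ T.dist r v ≤ n, (1 / 2 : ℝ) ^ T.dist r v +
      (Finset.univ.filter fun v =>
        v ∉ S ∧ ReachableAvoiding T S r v ∧ T.dist r v = n).card * (1 / 2 : ℝ) ^ n ≤ 1 := by
  induction n with
  | zero =>
    have hdist (v : V) : T.dist r v = 0 ↔ v = r := by
      rw [hT.connected.dist_eq_zero_iff, eq_comm]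
    by_cases hr : r ∈ S
    · have hL : (Finset.univ.filter fun v =>
          v ∉ S ∧ ReachableAvoiding T S r v ∧ T.dist r v = 0) = ∅ := by
        ext v
        simp only [hdist, Finset.mem_filter]
        grind
      have hA : (S.filter fun v => ReachableAvoiding T S r v ∧ T.dist r v ≤ 0) ⊆ {r} := by
        intro v
        simp only [Nat.le_zero, hdist, Finset.mem_filter, Finset.mem_singleton]
        grind
      rw [hL]
      calc _ ≤ ∑ v ∈ {r}, (1 / 2 : ℝ) ^ T.dist r v + (Finset.card (∅ : Finset V)) * (1 / 2) ^ 0 := by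
            gcongr
        _ = 1 := by simp
    · have hA : (S.filter fun v => ReachableAvoiding T S r v ∧ T.dist r v ≤ 0) = ∅ := by
        ext v
        simp only [Nat.le_zero, hdist, Finset.mem_filter]
        grind
      have hL : (Finset.univ.filter fun v =>
          v ∉ S ∧ ReachableAvoiding T S r v ∧ T.dist r v = 0) ⊆ {r} := by
        intro v
        simp only [hdist, Finset.mem_filter, Finset.mem_singleton]
        grind
      have := Finset.card_le_card hL
      rw [hA]
      simpa using this
  | succ n ih =>
    set L := Finset.univ.filter fun v => v ∉ S ∧ ReachableAvoiding T S r v ∧ T.dist r v = n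
      with hL
    set L' := Finset.univ.filter fun v =>
      v ∉ S ∧ ReachableAvoiding T S r v ∧ T.dist r v = n + 1 with hL'
    set A := S.filter fun v => ReachableAvoiding T S r v ∧ T.dist r v ≤ n with hA
    set B := S.filter fun v => ReachableAvoiding T S r v ∧ T.dist r v = n + 1 with hB
    have hAB : (S.filter fun v => ReachableAvoiding T S r v ∧ T.dist r v ≤ n + 1) = A ∪ B := by
      ext v
      simp only [hA, hB, Finset.mem_union, Finset.mem_filter]
      grind
    have hdisjAB : Disjoint A B := by
      rw [Finset.disjoint_left]
      simp only [hA, hB, Finset.mem_filter]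
      grind
    have hdisj : Disjoint B L' := by
      rw [Finset.disjoint_left]
      simp only [hB, hL', Finset.mem_filter]
      grind
    have hsub : B ∪ L' ⊆ L.biUnion fun u =>
        (T.neighborFinset u).filter fun w => T.dist r w = T.dist r u + 1 := by
      intro v hv
      have hv' : ReachableAvoiding T S r v ∧ T.dist r v = n + 1 := by
        simp only [hB, hL', Finset.mem_union, Finset.mem_filter] at hv
        grind
      obtain ⟨u, hadj, hu, hru, huS⟩ := hv'.1.exists_parent hT hv'.2
      simp only [hL, Finset.mem_biUnion, Finset.mem_filter, mem_neighborFinset]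
      exact ⟨u, ⟨Finset.mem_univ u, huS, hru, hu⟩, hadj, by rw [hv'.2, hu]⟩
    have hcard : B.card + L'.card ≤ L.card * 2 := by
      rw [← Finset.card_union_of_disjoint hdisj]
      exact (Finset.card_le_card hsub).trans
        (Finset.card_biUnion_le_card_mul _ _ _ fun u _ => hbin u)
    have hcardR : (B.card : ℝ) + L'.card ≤ L.card * 2 := by exact_mod_cast hcard
    have hsumB : ∑ v ∈ B, (1 / 2 : ℝ) ^ T.dist r v = B.card * (1 / 2) ^ (n + 1) := by
      rw [Finset.sum_congr rfl (g := fun _ => (1 / 2 : ℝ) ^ (n + 1)), Finset.sum_const,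
        nsmul_eq_mul]
      intro v hv
      rw [(Finset.mem_filter.1 hv).2.2]
    rw [hAB, Finset.sum_union hdisjAB, hsumB]
    have hpow : (0 : ℝ) ≤ (1 / 2) ^ (n + 1) := by positivity
    have := mul_le_mul_of_nonneg_right hcardR hpow
    calc _ = ∑ v ∈ A, (1 / 2 : ℝ) ^ T.dist r v + (B.card + L'.card) * (1 / 2) ^ (n + 1) := by ring
      _ ≤ ∑ v ∈ A, (1 / 2 : ℝ) ^ T.dist r v + L.card * 2 * (1 / 2) ^ (n + 1) := by gcongr
      _ = ∑ v ∈ A, (1 / 2 : ℝ) ^ T.dist r v + L.card * (1 / 2) ^ n := by ring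
      _ ≤ 1 := ih

/-- Lemma 6 (inequality part): if `T` is a binary rooted tree with root `r`
(every vertex has at most two children, where the children of `v` are the
neighbors of `v` farther from `r`) and `S` is any set of vertices,
then `w_{(T,S)}(r) ≤ 2`. -/
theorem expWeight_root_le_two_of_binary {V : Type*} [Fintype V] [DecidableEq V]
    (T : SimpleGraph V) [DecidableRel T.Adj] (hT : T.IsTree) (r : V)
    (hbin : ∀ v : V,
      ((T.neighborFinset v).filter fun w => T.dist r w = T.dist r v + 1).card ≤ 2)
    (S : Finset V) :
    expWeight T S r ≤ 2 := by
  classical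
  have hkraft := sum_half_pow_dist_add_card_le_one T hT r hbin S (S.sup (T.dist r))
  have hfilter : (S.filter fun v => ReachableAvoiding T S r v ∧ T.dist r v ≤ S.sup (T.dist r)) =
      S.filter (ReachableAvoiding T S r) :=
    Finset.filter_congr fun v hv => and_iff_left (Finset.le_sup hv)
  rw [hfilter] at hkraft
  have hsum : ∑ v ∈ S with ReachableAvoiding T S r v, (1 / 2 : ℝ) ^ T.dist r v ≤ 1 :=
    (le_add_of_nonneg_right (by positivity)).trans hkraft
  calc expWeight T S r
      = ∑ v ∈ S with ReachableAvoiding T S r v, expStep (expDist T S r v) := by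
        refine (Finset.sum_filter_of_ne fun v _ hv => ?_).symm
        by_contra h
        exact hv (by simp [expDist_eq_top h, expStep])
    _ ≤ ∑ v ∈ S with ReachableAvoiding T S r v, 2 * (1 / 2 : ℝ) ^ T.dist r v :=
        Finset.sum_le_sum fun v _ => expStep_le_of_le (dist_le_expDist T S r v)
    _ = 2 * ∑ v ∈ S with ReachableAvoiding T S r v, (1 / 2 : ℝ) ^ T.dist r v := by
        rw [Finset.mul_sum]
    _ ≤ 2 := by linarith
end
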